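/- Let q be an odd prime power, n ≥ 1, let s be such that 2^(s+1) exactly divides q² − 1, and let r_t be the natural number with 2^(r_t) ≤ 2n < 2^(r_t+1). Then exp_2(Sp_{2n}(F_q)) = 2^(s + r_t − 1). -/

import Mathlib

open Matrix Polynomial

theorem padicValNat_two_pow_two_mul_sub_one {q s e : ℕ} (hq : 1 < q) (hodd : Odd q)
    (hs : 2 ^ (s + 1) ∣ q ^ 2 - 1 ∧ ¬ 2 ^ (s + 2) ∣ q ^ 2 - 1) (he : e ≠ 0) :
    padicValNat 2 (q ^ (2 * e) - 1) = s + 1 + padicValNat 2 e := by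
  have h2 : ¬ 2 ∣ q := by rwa [← even_iff_two_dvd, Nat.not_even_iff_odd]
  have hsq : padicValNat 2 (q ^ 2 - 1) = s + 1 := by
    have hne : q ^ 2 - 1 ≠ 0 := by
      have := Nat.one_lt_pow (two_ne_zero) hq
      omega
    rw [padicValNat_dvd_iff_le hne, padicValNat_dvd_iff_le hne] at hs
    omega
  have h₁ := padicValNat.pow_two_sub_one hq h2 two_ne_zero even_two
  have h₂ := padicValNat.pow_two_sub_one hq h2 (n := 2 * e) (by omega) (even_two_mul e)
  rw [padicValNat.mul two_ne_zero he] at h₂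
  omega

theorem not_two_pow_dvd_of_lt_two_pow {q s r e : ℕ} (hq : 1 < q) (hodd : Odd q)
    (hs : 2 ^ (s + 1) ∣ q ^ 2 - 1 ∧ ¬ 2 ^ (s + 2) ∣ q ^ 2 - 1) (he : e ≠ 0) (her : e < 2 ^ r) :
    ¬ 2 ^ (s + r) ∣ q ^ e - 1 ∧ ¬ 2 ^ (s + r) ∣ q ^ e + 1 := by
  have hqe : 1 < q ^ e := Nat.one_lt_pow he hq
  have hv := padicValNat_two_pow_two_mul_sub_one hq hodd hs he
  have hfac : q ^ (2 * e) - 1 = (q ^ e + 1) * (q ^ e - 1) := by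
    rw [mul_comm 2, pow_mul, ← Nat.sq_sub_sq, one_pow]
  have hne : q ^ e - 1 ≠ 0 := by omega
  rw [hfac, padicValNat.mul (by omega) hne] at hv
  obtain ⟨m, hm⟩ := hodd.pow (n := e)
  have h₁ : 1 ≤ padicValNat 2 (q ^ e + 1) :=
    one_le_padicValNat_of_dvd (by omega) (by omega)
  have h₂ : 1 ≤ padicValNat 2 (q ^ e - 1) :=
    one_le_padicValNat_of_dvd hne (by omega)
  have her' : padicValNat 2 e < r := by
    refine (Nat.pow_lt_pow_iff_right one_lt_two).1 ?_
    exact (Nat.le_of_dvd (Nat.pos_of_ne_zero he) pow_padicValNat_dvd).trans_lt her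
  rw [padicValNat_dvd_iff_le hne, padicValNat_dvd_iff_le (by omega)]
  omega

section UpperBound

variable {K : Type*} [Field K] {x : K} {q s r : ℕ}

theorem pow_q_pow_injective (hq : 1 < q) (hodd : Odd q)
    (hs : 2 ^ (s + 1) ∣ q ^ 2 - 1 ∧ ¬ 2 ^ (s + 2) ∣ q ^ 2 - 1) (hx : orderOf x = 2 ^ (s + r)) :
    Function.Injective fun i : Fin (2 ^ r) => x ^ q ^ (i : ℕ) := by
  have hx0 : x ≠ 0 := by
    rintro rfl
    rw [orderOf_zero] at hx
    exact (pow_ne_zero _ two_ne_zero) hx.symm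
  suffices H : ∀ i j : ℕ, i < j → j < 2 ^ r → x ^ q ^ i ≠ x ^ q ^ j by
    intro i j hij
    rcases lt_trichotomy (i : ℕ) j with h | h | h
    · exact (H i j h j.2 hij).elim
    · exact Fin.ext h
    · exact (H j i h i.2 hij.symm).elim
  intro i j hij hj h
  refine (not_two_pow_dvd_of_lt_two_pow hq hodd hs (e := j - i) (r := r) (by omega) (by omega)).1 ?_
  have hcop : (2 ^ (s + r)).Coprime (q ^ i) :=
    Nat.Coprime.pow _ _ (Nat.coprime_two_left.2 hodd)
  refine hcop.dvd_of_dvd_mul_left ?_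
  rw [← hx, Nat.mul_sub, mul_one, ← pow_add, Nat.add_sub_cancel' hij.le]
  refine orderOf_dvd_of_pow_eq_one ?_
  rw [pow_sub₀ _ hx0 (Nat.pow_le_pow_right (by omega) hij.le), ← h,
    mul_inv_cancel₀ (pow_ne_zero _ hx0)]

theorem pow_q_pow_ne_inv (hq : 1 < q) (hodd : Odd q)
    (hs : 2 ^ (s + 1) ∣ q ^ 2 - 1 ∧ ¬ 2 ^ (s + 2) ∣ q ^ 2 - 1) (hsr : 2 ≤ s + r)
    (hx : orderOf x = 2 ^ (s + r)) (i j : Fin (2 ^ r)) :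
    x ^ q ^ (i : ℕ) ≠ (x ^ q ^ (j : ℕ))⁻¹ := by
  have hx0 : x ≠ 0 := by
    rintro rfl
    rw [orderOf_zero] at hx
    exact (pow_ne_zero _ two_ne_zero) hx.symm
  suffices H : ∀ i j : ℕ, i ≤ j → j < 2 ^ r → x ^ q ^ i * x ^ q ^ j ≠ 1 by
    intro h
    rw [← mul_eq_one_iff_eq_inv₀ (pow_ne_zero _ hx0)] at h
    rcases le_total (i : ℕ) j with hij | hij
    · exact H i j hij j.2 h
    · exact H j i hij i.2 (by rwa [mul_comm])
  intro i j hij hj h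
  have hdvd : 2 ^ (s + r) ∣ q ^ (j - i) + 1 := by
    have hcop : (2 ^ (s + r)).Coprime (q ^ i) :=
      Nat.Coprime.pow _ _ (Nat.coprime_two_left.2 hodd)
    refine hcop.dvd_of_dvd_mul_left ?_
    rw [mul_add, ← pow_add, Nat.add_sub_cancel' hij, mul_one, ← hx]
    refine orderOf_dvd_of_pow_eq_one ?_
    rw [pow_add, mul_comm, h]
  rcases eq_or_ne (j - i) 0 with h0 | h0
  · rw [h0, pow_zero] at hdvd
    have h4 : 2 ^ 2 ∣ 1 + 1 := (pow_dvd_pow 2 hsr).trans hdvd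
    norm_num at h4
  · exact (not_two_pow_dvd_of_lt_two_pow hq hodd hs h0 (by omega)).2 hdvd

end UpperBound

theorem SymplecticGroup.isRoot_charpoly_inv {l K : Type*} [DecidableEq l] [Fintype l]
    [Field K] {A : Matrix (l ⊕ l) (l ⊕ l) K} (hA : A ∈ symplecticGroup l K) {x : K}
    (hx : A.charpoly.IsRoot x) : A.charpoly.IsRoot x⁻¹ := by
  rw [IsRoot.def, eval_charpoly] at hx ⊢
  have hdet : A.det ≠ 0 := (symplectic_det hA).ne_zero
  have hx0 : x ≠ 0 := by
    rintro rfl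
    simp [det_neg, hdet] at hx
  have hJ : (J l K).det ≠ 0 := (isUnit_det_J l K).ne_zero
  have key : (scalar (l ⊕ l) x⁻¹ - A) * (J l K * Aᵀ) =
      (-x⁻¹) • (J l K * (scalar (l ⊕ l) x - A)ᵀ) := by
    rw [mem_iff] at hA
    simp only [scalar_apply, ← smul_one_eq_diagonal]
    rw [sub_mul, ← mul_assoc A, hA, transpose_sub, transpose_smul, transpose_one, mul_sub,
      Matrix.smul_mul, Matrix.mul_smul, one_mul, mul_one, smul_sub, smul_smul, neg_mul,
      inv_mul_cancel₀ hx0, neg_smul, neg_smul, one_smul]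
    abel
  have := congrArg det key
  rw [det_mul, det_mul, det_smul, det_mul, det_transpose, det_transpose, hx, mul_zero,
    mul_zero] at this
  simpa [hJ, hdet] using this

theorem FiniteField.aeval_pow_card_pow {F K : Type*} [Field F] [Fintype F] [CommRing K]
    [Algebra F K] (f : F[X]) {x : K} (hx : aeval x f = 0) (i : ℕ) :
    aeval (x ^ Fintype.card F ^ i) f = 0 := by
  induction i with
  | zero => simpa
  | succ i ih =>
    rw [pow_succ, pow_mul, ← expand_aeval, FiniteField.expand_card, map_pow, ih,
      zero_pow Fintype.card_ne_zero]

theorem Matrix.exists_isRoot_charpoly_orderOf_eq {ι K : Type*} [DecidableEq ι] [Fintype ι]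
    [Field K] [IsAlgClosed K] (h2 : (2 : K) ≠ 0) {A : Matrix ι ι K} {k : ℕ}
    (hA : orderOf A = 2 ^ (k + 1)) : ∃ x : K, A.charpoly.IsRoot x ∧ orderOf x = 2 ^ (k + 1) := by
  have hN : 0 < 2 ^ k := by positivity
  have hne : A ^ 2 ^ k ≠ 1 := pow_ne_one_of_lt_orderOf hN.ne' <| by
    rw [hA]; exact Nat.pow_lt_pow_right one_lt_two k.lt_succ_self
  have hmem : (-1 : K) ∈ spectrum K (A ^ 2 ^ k) := by
    rw [spectrum.mem_iff]
    intro hu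
    refine hne (sub_eq_zero.1 ?_)
    refine (hu.mul_right_eq_zero).1 ?_
    have hsq : A ^ 2 ^ k * A ^ 2 ^ k = 1 := by
      rw [← pow_add, ← two_mul, ← pow_succ', ← hA, pow_orderOf_eq_one]
    rw [map_neg, map_one]
    rw [sub_mul, mul_sub, mul_sub, hsq]
    noncomm_ring
  rw [spectrum.map_pow_of_pos A hN] at hmem
  obtain ⟨x, hx, hx1⟩ := hmem
  refine ⟨x, mem_spectrum_iff_isRoot_charpoly.1 hx, orderOf_eq_prime_pow (p := 2) ?_ ?_⟩
  · simp only at hx1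
    rw [hx1]
    intro h
    apply h2
    linear_combination -h
  · simp only at hx1
    rw [pow_succ, pow_mul, hx1, neg_one_sq]

theorem SymplecticGroup.two_pow_le_card_of_isRoot {F K l : Type*} [Field F] [Fintype F] [Field K]
    [Algebra F K] [DecidableEq l] [Fintype l] {s r : ℕ} (hodd : Odd (Fintype.card F))
    (hs : 2 ^ (s + 1) ∣ Fintype.card F ^ 2 - 1 ∧ ¬ 2 ^ (s + 2) ∣ Fintype.card F ^ 2 - 1)
    (hsr : 2 ≤ s + r) {A : Matrix (l ⊕ l) (l ⊕ l) F} (hA : A ∈ symplecticGroup l F) {x : K}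
    (hx : (A.map (algebraMap F K)).charpoly.IsRoot x) (hxo : orderOf x = 2 ^ (s + r)) :
    2 ^ r ≤ Fintype.card l := by
  classical
  set B : Matrix (l ⊕ l) (l ⊕ l) K := A.map (algebraMap F K)
  have hB : B ∈ symplecticGroup l K :=
    SymplecticGroup.map_mem hA (algebraMap F K)
  have hroot (i : ℕ) : B.charpoly.IsRoot (x ^ Fintype.card F ^ i) := by
    have hBc : B.charpoly = A.charpoly.map (algebraMap F K) := charpoly_map _ _
    rw [hBc, IsRoot.def, eval_map_algebraMap] at hx ⊢
    exact FiniteField.aeval_pow_card_pow _ hx i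
  have hinj := pow_q_pow_injective (Fintype.one_lt_card (α := F)) hodd hs hxo
  have hinj' := hinj.sumElim (inv_injective.comp hinj)
    fun i j => pow_q_pow_ne_inv Fintype.one_lt_card hodd hs hsr hxo i j
  have hcard : Fintype.card (Fin (2 ^ r) ⊕ Fin (2 ^ r)) ≤ B.charpoly.natDegree := by
    refine le_trans ?_ ((Multiset.toFinset_card_le _).trans (card_roots' B.charpoly))
    rw [← Finset.card_univ, ← Finset.card_image_of_injective _ hinj']
    refine Finset.card_le_card fun y hy => ?_
    rw [Multiset.mem_toFinset, mem_roots B.charpoly_monic.ne_zero]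
    simp only [Finset.mem_image, Finset.mem_univ, true_and] at hy
    obtain ⟨i | i, rfl⟩ := hy
    · exact hroot i
    · exact isRoot_charpoly_inv hB (hroot i)
  rw [charpoly_natDegree_eq_dim] at hcard
  simp only [Fintype.card_sum, Fintype.card_fin] at hcard
  omega

theorem SymplecticGroup.orderOf_ne_two_pow {F l : Type*} [Field F] [Fintype F]
    [DecidableEq l] [Fintype l] {s r : ℕ} (hodd : Odd (Fintype.card F))
    (hs : 2 ^ (s + 1) ∣ Fintype.card F ^ 2 - 1 ∧ ¬ 2 ^ (s + 2) ∣ Fintype.card F ^ 2 - 1)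
    (hsr : 2 ≤ s + r) (hl : Fintype.card l < 2 ^ r) (A : symplecticGroup l F) :
    orderOf A ≠ 2 ^ (s + r) := by
  intro hA
  let φ := algebraMap F (AlgebraicClosure F)
  have hBA : orderOf ((A : Matrix (l ⊕ l) (l ⊕ l) F).map φ) = 2 ^ (s + r) := by
    rw [← hA, ← orderOf_submonoid]
    exact orderOf_injective
      ((φ.mapMatrix : _ →+* Matrix (l ⊕ l) (l ⊕ l) (AlgebraicClosure F)) :
        Matrix (l ⊕ l) (l ⊕ l) F →* Matrix (l ⊕ l) (l ⊕ l) (AlgebraicClosure F))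
      (Matrix.map_injective φ.injective) _
  have hF : (2 : F) ≠ 0 := Ring.two_ne_zero fun h =>
    (Nat.not_even_iff_odd.2 hodd) (Nat.even_iff.2 (FiniteField.even_card_of_char_two h))
  have h2 : (2 : AlgebraicClosure F) ≠ 0 := by
    rw [← map_ofNat φ 2]
    exact (_root_.map_ne_zero _).2 hF
  obtain ⟨k, hk⟩ : ∃ k, s + r = k + 1 := ⟨s + r - 1, by omega⟩
  obtain ⟨x, hx, hxo⟩ := exists_isRoot_charpoly_orderOf_eq h2 (hk ▸ hBA)
  rw [← hk] at hxo
  exact hl.not_ge (two_pow_le_card_of_isRoot hodd hs hsr A.2 hx hxo)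

theorem Monoid.exists_orderOf_eq_prime_pow_of_dvd_exponent {G : Type*} [Monoid G] {p k : ℕ}
    (hp : p.Prime) (hG : Monoid.exponent G ≠ 0) (h : p ^ k ∣ Monoid.exponent G) :
    ∃ g : G, orderOf g = p ^ k := by
  obtain ⟨g, hg⟩ := hp.exists_orderOf_eq_pow_factorization_exponent G
  have hdvd : p ^ k ∣ orderOf g := by
    rw [hg]
    exact pow_dvd_pow p ((hp.pow_dvd_iff_le_factorization hG).1 h)
  exact ⟨_, orderOf_pow_orderOf_div (by rw [hg]; exact pow_ne_zero _ hp.ne_zero) hdvd⟩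

theorem Matrix.orderOf_dvd_exponent_symplecticGroup {n : Type*} [DecidableEq n] [Fintype n]
    {R : Type*} [CommRing R] (u : (Matrix n n R)ˣ) :
    orderOf u ∣ Monoid.exponent (symplecticGroup n R) := by
  set B : Matrix n n R := ((u⁻¹ : (Matrix n n R)ˣ) : Matrix n n R)ᵀ with hB
  have hmem : fromBlocks (u : Matrix n n R) 0 0 B ∈ symplecticGroup n R := by
    rw [SymplecticGroup.fromBlocks_mem_iff]
    simp [hB, ← transpose_mul]
  refine dvd_trans (orderOf_dvd_of_pow_eq_one ?_)
    (Monoid.order_dvd_exponent (⟨_, hmem⟩ : symplecticGroup n R))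
  have h := congrArg Subtype.val (pow_orderOf_eq_one (⟨_, hmem⟩ : symplecticGroup n R))
  rw [SubmonoidClass.coe_pow, fromBlocks_diagonal_pow, Submonoid.coe_one, ← fromBlocks_one,
    fromBlocks_inj] at h
  exact Units.ext h.1

theorem FiniteField.exists_orderOf_eq {L : Type*} [Field L] [Finite L] {N : ℕ}
    (hN : N ∣ Nat.card L - 1) : ∃ x : Lˣ, orderOf x = N := by
  obtain ⟨g, hg⟩ := IsCyclic.exists_ofOrder_eq_natCard (α := Lˣ)
  rw [Nat.card_units] at hg
  rw [← hg] at hN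
  exact ⟨_, orderOf_pow_orderOf_div (orderOf_pos g).ne' hN⟩

theorem Matrix.exponent_symplecticGroup_dvd_of_pow {F : Type*} [Field F] [Finite F] {m n N : ℕ}
    (hm : m ≠ 0) (hmn : m ≤ n) (hN : N ∣ Nat.card F ^ m - 1) :
    N ∣ Monoid.exponent (symplecticGroup (Fin n) F) := by
  obtain ⟨p, hp⟩ := CharP.exists F
  have : Fact p.Prime := ⟨CharP.char_is_prime F p⟩
  have : NeZero m := ⟨hm⟩
  let L := FiniteField.Extension F p m
  obtain ⟨x, hx⟩ := FiniteField.exists_orderOf_eq (L := L) (N := N)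
    (by rwa [FiniteField.natCard_extension])
  let R := L × (Fin (n - m) → F)
  have hR : Module.finrank F R = n := by
    rw [Module.finrank_prod, FiniteField.finrank_extension, Module.finrank_fin_fun]
    omega
  let b : Module.Basis (Fin n) F R := Module.finBasisOfFinrankEq F R hR
  let f : Lˣ →* (Matrix (Fin n) (Fin n) F)ˣ :=
    (Units.map ((Algebra.leftMulMatrix b : R →ₐ[F] _) : R →* Matrix (Fin n) (Fin n) F)).comp
      (Units.map (MonoidHom.inl L (Fin (n - m) → F)))
  have hf : Function.Injective f :=
    (Units.map_injective (Algebra.leftMulMatrix_injective b)).comp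
      (Units.map_injective fun _ _ h => congrArg Prod.fst h)
  rw [← hx, ← orderOf_injective f hf]
  exact orderOf_dvd_exponent_symplecticGroup _

theorem SymplecticGroup.mem_fin_one_iff {R : Type*} [CommRing R]
    {A : Matrix (Fin 1 ⊕ Fin 1) (Fin 1 ⊕ Fin 1) R} :
    A ∈ symplecticGroup (Fin 1) R ↔ A.det = 1 := by
  refine ⟨det_eq_one, fun h => ?_⟩
  have hA : A = fromBlocks A.toBlocks₁₁ A.toBlocks₁₂ A.toBlocks₂₁ A.toBlocks₂₂ :=
    (fromBlocks_toBlocks A).symm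
  have hdet : A.det = A (.inl 0) (.inl 0) * A (.inr 0) (.inr 0) -
      A (.inl 0) (.inr 0) * A (.inr 0) (.inl 0) := by
    rw [← det_reindex_self finSumFinEquiv A]
    exact det_fin_two _
  rw [hA, fromBlocks_mem_iff]
  refine ⟨?_, ?_, ?_⟩ <;> ext i j <;> fin_cases i <;> fin_cases j <;>
    simp [mul_apply, toBlocks₁₁, toBlocks₁₂, toBlocks₂₁, toBlocks₂₂, mul_comm]
  linear_combination h - hdet

theorem Matrix.card_add_one_dvd_exponent_symplecticGroup {F : Type*} [Field F] [Finite F] :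
    Nat.card F + 1 ∣ Monoid.exponent (symplecticGroup (Fin 1) F) := by
  obtain ⟨p, hp⟩ := CharP.exists F
  have : Fact p.Prime := ⟨CharP.char_is_prime F p⟩
  let L := FiniteField.Extension F p 2
  have hfac : Nat.card F ^ 2 - 1 = (Nat.card F + 1) * (Nat.card F - 1) := by
    rw [← Nat.sq_sub_sq, one_pow]
  have hL : Module.finrank F L = 2 := FiniteField.finrank_extension F p 2
  have hcL : Nat.card L = Nat.card F ^ 2 := FiniteField.natCard_extension F p 2
  obtain ⟨x, hx⟩ := FiniteField.exists_orderOf_eq (L := L) (N := Nat.card F + 1)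
    (by rw [hcL, hfac]; exact dvd_mul_right _ _)
  have hnorm : Algebra.norm F (x : L) = 1 := by
    apply (algebraMap F L).injective
    have hF : 1 < Nat.card F := Finite.one_lt_card
    rw [FiniteField.algebraMap_norm_eq_pow, hcL, hfac, Nat.mul_div_cancel _ (by omega), ← hx,
      ← Units.val_pow_eq_pow_val, pow_orderOf_eq_one, Units.val_one, map_one]
  let b : Module.Basis (Fin 1 ⊕ Fin 1) F L :=
    (Module.finBasisOfFinrankEq F L hL).reindex (finSumFinEquiv (m := 1) (n := 1)).symm
  have hmem : Algebra.leftMulMatrix b (x : L) ∈ symplecticGroup (Fin 1) F := by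
    rw [SymplecticGroup.mem_fin_one_iff, ← Algebra.norm_eq_matrix_det, hnorm]
  have horder : orderOf (⟨_, hmem⟩ : symplecticGroup (Fin 1) F) = Nat.card F + 1 := by
    rw [← orderOf_submonoid, ← hx, ← orderOf_units]
    exact orderOf_injective ((Algebra.leftMulMatrix b : L →ₐ[F] _) : L →* Matrix (Fin 1 ⊕ Fin 1) (Fin 1 ⊕ Fin 1) F)
      (Algebra.leftMulMatrix_injective b) _
  rw [← horder]
  exact Monoid.order_dvd_exponent _

theorem two_pow_dvd_add_one_or_sub_one {q s : ℕ} (hodd : Odd q) (h : 2 ^ (s + 1) ∣ q ^ 2 - 1) :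
    2 ^ s ∣ q + 1 ∨ 2 ^ s ∣ q - 1 := by
  obtain ⟨m, rfl⟩ := hodd
  have hfac : (2 * m + 1) ^ 2 - 1 = 2 * (2 * ((m + 1) * m)) := by
    rw [Nat.sub_eq_iff_eq_add (Nat.one_le_pow _ _ (by omega))]; ring
  rw [hfac, pow_succ', Nat.mul_dvd_mul_iff_left two_pos] at h
  rcases s with _ | s
  · simp
  rw [pow_succ', Nat.mul_dvd_mul_iff_left two_pos] at h
  have hcop : Nat.Coprime (m + 1) m := by simp
  rw [show 2 * m + 1 + 1 = 2 * (m + 1) by ring, Nat.add_sub_cancel, pow_succ',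
    Nat.mul_dvd_mul_iff_left two_pos, Nat.mul_dvd_mul_iff_left two_pos]
  rcases m.even_or_odd with hm | hm
  · right
    exact (Nat.Coprime.pow_left s (Nat.coprime_two_left.2 hm.add_one)).dvd_of_dvd_mul_left h
  · left
    exact (Nat.Coprime.pow_left s (Nat.coprime_two_left.2 hm)).dvd_of_dvd_mul_right h


/-- Let `q` be an odd prime power, `n ≥ 1`, let `2^(s+1)` exactly divide `q² - 1`,
and `2^(r_t) ≤ 2n < 2^(r_t+1)`. Then the `2`-part of the exponent of `Sp_{2n}(F_q)`
is `2^(s + r_t - 1)`. -/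
theorem exponent_two_part_symplecticGroup (q : ℕ) (hq : IsPrimePow q) (hqodd : Odd q)
    (F : Type) [Field F] [Fintype F] (hF : Fintype.card F = q)
    (n s rt : ℕ) (hn : 1 ≤ n)
    (hs : 2 ^ (s + 1) ∣ q ^ 2 - 1 ∧ ¬ 2 ^ (s + 2) ∣ q ^ 2 - 1)
    (hrt1 : 2 ^ rt ≤ 2 * n) (hrt2 : 2 * n < 2 ^ (rt + 1)) :
    2 ^ (s + rt - 1) ∣ Monoid.exponent (Matrix.symplecticGroup (Fin n) F) ∧
      ¬ 2 ^ (s + rt - 1 + 1) ∣ Monoid.exponent (Matrix.symplecticGroup (Fin n) F) := by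
  have hq1 : 1 < q := hq.one_lt
  have hnrt : n < 2 ^ rt := by rw [pow_succ] at hrt2; omega
  have hrt : 1 ≤ rt := Nat.one_le_iff_ne_zero.2 fun h => by simp [h] at hnrt; omega
  have hs1 : 1 ≤ s := Nat.one_le_iff_ne_zero.2 fun h => by
    refine hs.2 (h ▸ Dvd.dvd.trans ?_ (Nat.eight_dvd_sq_sub_one_of_odd hqodd))
    norm_num
  refine ⟨?_, fun h => ?_⟩
  · rcases eq_or_lt_of_le hrt with rfl | hrt'
    · obtain rfl : n = 1 := by omega
      rw [Nat.add_sub_cancel]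
      rcases two_pow_dvd_add_one_or_sub_one hqodd hs.1 with h | h
      · refine h.trans ?_
        rw [← hF, ← Nat.card_eq_fintype_card]
        exact card_add_one_dvd_exponent_symplecticGroup
      · refine exponent_symplecticGroup_dvd_of_pow one_ne_zero le_rfl ?_
        rwa [Nat.card_eq_fintype_card, hF, pow_one]
    · obtain ⟨r, rfl⟩ : ∃ r, rt = r + 2 := ⟨rt - 2, by omega⟩
      refine exponent_symplecticGroup_dvd_of_pow (m := 2 * 2 ^ r) (by positivity)
        (by rw [pow_add] at hrt1; omega) ?_
      have hv := padicValNat_two_pow_two_mul_sub_one hq1 hqodd hs (e := 2 ^ r) (by positivity)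
      rw [padicValNat.prime_pow] at hv
      rw [Nat.card_eq_fintype_card, hF, show s + (r + 2) - 1 = s + 1 + r by omega, ← hv]
      exact pow_padicValNat_dvd
  · subst hF
    rw [Nat.sub_add_cancel (by omega)] at h
    obtain ⟨A, hA⟩ := Monoid.exists_orderOf_eq_prime_pow_of_dvd_exponent Nat.prime_two
      Monoid.exponent_ne_zero_of_finite h
    exact SymplecticGroup.orderOf_ne_two_pow hqodd hs (by omega) (by simpa using hnrt) A hA
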